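/- Let ν ∈ (0,1], μ > 0, and let j, k be natural numbers with j ≥ 1 and k ≥ 1. Then for every t > 0 the convolution identity ∫_0^t [μ^j s^{νj - 1} E^j_{ν, νj}(-μ s^ν)] · [μ^k (t - s)^{νk - 1} E^k_{ν, νk}(-μ (t - s)^ν)] ds = μ^{j+k} t^{ν(j+k) - 1} E^{j+k}_{ν, ν(j+k)}(-μ t^ν) holds, where E^γ_{α,β}(z) = ∑_{m=0}^∞ Γ(γ + m) z^m / (Γ(γ) · m! · Γ(αm + β)). -/

import Mathlib

open MeasureTheory Real

/-- The three-parameter (Prabhakar) generalized Mittag--Leffler function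
`E^γ_{α,β}(z) = ∑_{m} Γ(γ + m) z^m / (Γ(γ) m! Γ(αm + β))`. -/
noncomputable def mittagLeffler3 (α β γ z : ℝ) : ℝ :=
  ∑' m : ℕ,
    Real.Gamma (γ + m) * z ^ m /
      (Real.Gamma γ * (Nat.factorial m : ℝ) * Real.Gamma (α * m + β))

/-- The coefficients `Γ(γ + m) / (Γ(γ) m!)` of the binomial series of `(1 - x) ^ (-γ)`. -/
noncomputable def binomialCoeff (γ : ℝ) (m : ℕ) : ℝ :=
  Real.Gamma (γ + m) / (Real.Gamma γ * (Nat.factorial m : ℝ))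

lemma binomialCoeff_pos {γ : ℝ} (hγ : 0 < γ) (m : ℕ) : 0 < binomialCoeff γ m := by
  have h₁ := Real.Gamma_pos_of_pos hγ
  have h₂ : 0 < Real.Gamma (γ + m) := Real.Gamma_pos_of_pos (by positivity)
  unfold binomialCoeff
  positivity

lemma binomialCoeff_zero {γ : ℝ} (hγ : 0 < γ) : binomialCoeff γ 0 = 1 := by
  simp [binomialCoeff, (Real.Gamma_pos_of_pos hγ).ne']

lemma binomialCoeff_succ {γ : ℝ} (hγ : 0 < γ) (m : ℕ) :
    ((m + 1 : ℕ) : ℝ) * binomialCoeff γ (m + 1) = (γ + m) * binomialCoeff γ m := by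
  have h₁ := (Real.Gamma_pos_of_pos hγ).ne'
  have h₂ : γ + m ≠ 0 := by positivity
  have h₃ : (Nat.factorial m : ℝ) ≠ 0 := by positivity
  have h₄ : (m + 1 : ℝ) ≠ 0 := by positivity
  have h₅ : Real.Gamma (γ + (m + 1 : ℕ)) = (γ + m) * Real.Gamma (γ + m) := by
    rw [← Real.Gamma_add_one h₂]
    push_cast
    ring_nf
  rw [binomialCoeff, binomialCoeff, h₅, Nat.factorial_succ]
  push_cast
  field_simp

/-- The Chu–Vandermonde identity for rising factorials. -/
lemma sum_antidiagonal_binomialCoeff {γ δ : ℝ} (hγ : 0 < γ) (hδ : 0 < δ) (N : ℕ) :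
    ∑ p ∈ Finset.HasAntidiagonal.antidiagonal N, binomialCoeff γ p.1 * binomialCoeff δ p.2 =
      binomialCoeff (γ + δ) N := by
  induction N with
  | zero => simp [binomialCoeff_zero, hγ, hδ, add_pos hγ hδ]
  | succ N ih =>
    have hN : ((N + 1 : ℕ) : ℝ) ≠ 0 := by positivity
    apply mul_left_cancel₀ hN
    rw [binomialCoeff_succ (add_pos hγ hδ), ← ih, Finset.mul_sum, Finset.mul_sum]
    have hsplit : ∑ p ∈ Finset.HasAntidiagonal.antidiagonal (N + 1),
        ((N + 1 : ℕ) : ℝ) * (binomialCoeff γ p.1 * binomialCoeff δ p.2) =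
        ∑ p ∈ Finset.HasAntidiagonal.antidiagonal (N + 1),
          (p.1 : ℝ) * binomialCoeff γ p.1 * binomialCoeff δ p.2 +
        ∑ p ∈ Finset.HasAntidiagonal.antidiagonal (N + 1),
          binomialCoeff γ p.1 * ((p.2 : ℝ) * binomialCoeff δ p.2) := by
      rw [← Finset.sum_add_distrib]
      refine Finset.sum_congr rfl fun p hp => ?_
      rw [← Finset.HasAntidiagonal.mem_antidiagonal.1 hp]
      push_cast
      ring
    rw [hsplit, Finset.Nat.sum_antidiagonal_succ, Finset.Nat.sum_antidiagonal_succ']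
    simp only [binomialCoeff_succ hγ, binomialCoeff_succ hδ, Nat.cast_zero, zero_mul, mul_zero,
      zero_add]
    rw [← Finset.sum_add_distrib]
    refine Finset.sum_congr rfl fun p hp => ?_
    rw [← Finset.HasAntidiagonal.mem_antidiagonal.1 hp]
    push_cast
    ring

lemma summable_binomialCoeff_mul_half_pow {γ : ℝ} (hγ : 0 < γ) :
    Summable fun m : ℕ => binomialCoeff γ m * (1 / 2 : ℝ) ^ m := by
  refine summable_of_ratio_test_tendsto_lt_one (l := 1 / 2) (by norm_num)
    (Filter.Eventually.of_forall fun m => ?_) ?_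
  · have := binomialCoeff_pos hγ m
    positivity
  · have hratio : ∀ m : ℕ, ‖binomialCoeff γ (m + 1) * (1 / 2 : ℝ) ^ (m + 1)‖ /
        ‖binomialCoeff γ m * (1 / 2 : ℝ) ^ m‖ = (m + γ) / (m + 1) * (1 / 2) := by
      intro m
      have h₁ := binomialCoeff_pos hγ m
      have h₂ := binomialCoeff_pos hγ (m + 1)
      have h₃ := binomialCoeff_succ hγ m
      push_cast at h₃
      rw [Real.norm_of_nonneg (by positivity), Real.norm_of_nonneg (by positivity)]
      rw [show binomialCoeff γ (m + 1) = (γ + m) * binomialCoeff γ m / (m + 1) by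
        rw [← h₃]; field_simp]
      field_simp
      ring
    simp_rw [hratio]
    have hlim : Filter.Tendsto (fun m : ℕ => ((m : ℝ) + γ) / (m + 1)) Filter.atTop (nhds 1) := by
      simpa using tendsto_add_mul_div_add_mul_atTop_nhds γ 1 1 (one_ne_zero (α := ℝ)) |>.congr
        fun m => by ring_nf
    simpa using hlim.mul_const (1 / 2 : ℝ)

lemma exp_neg_mul_rpow_le_Gamma {R x : ℝ} (hR : 0 < R) (hx : 1 ≤ x) :
    Real.exp (-(2 * R)) * R ^ x ≤ Real.Gamma x := by
  have hx0 : 0 < x := by linarith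
  have hInt : IntegrableOn (fun s : ℝ => s ^ (x - 1) * Real.exp (-(R * s))) (Set.Ioi 0) := by
    have := integrableOn_rpow_mul_exp_neg_mul_rpow (p := 1) (s := x - 1) (b := R)
      (by linarith) one_pos hR
    simpa using this
  have hle : Real.exp (-(2 * R)) ≤ ∫ s in Set.Ioi (0 : ℝ), s ^ (x - 1) * Real.exp (-(R * s)) := by
    calc Real.exp (-(2 * R)) = ∫ s in Set.Ioc (1 : ℝ) 2, Real.exp (-(2 * R)) := by
          simp; norm_num
      _ ≤ ∫ s in Set.Ioc (1 : ℝ) 2, s ^ (x - 1) * Real.exp (-(R * s)) := by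
          refine setIntegral_mono_on (by simp)
            (hInt.mono_set fun s hs => lt_trans one_pos hs.1) measurableSet_Ioc fun s hs => ?_
          have h₁ : 1 ≤ s ^ (x - 1) := Real.one_le_rpow hs.1.le (by linarith)
          have h₂ : Real.exp (-(2 * R)) ≤ Real.exp (-(R * s)) :=
            Real.exp_le_exp.2 (by nlinarith [hs.2])
          nlinarith [Real.exp_pos (-(R * s))]
      _ ≤ _ := by
          refine setIntegral_mono_set hInt ?_ (Filter.Eventually.of_forall
            fun s (hs : s ∈ Set.Ioc (1 : ℝ) 2) => lt_trans one_pos hs.1)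
          refine (ae_restrict_iff' measurableSet_Ioi).2 (Filter.Eventually.of_forall fun s hs => ?_)
          have : (0 : ℝ) < s := hs
          simp only [Pi.zero_apply]
          positivity
  rw [Real.integral_rpow_mul_exp_neg_mul_Ioi hx0 hR, one_div, Real.inv_rpow hR.le] at hle
  have hRx : 0 < R ^ x := by positivity
  calc _ ≤ (R ^ x)⁻¹ * Real.Gamma x * R ^ x := by gcongr
    _ = _ := by field_simp

/-- The series of the Prabhakar function converges absolutely. -/
lemma summable_prabhakar {α β γ : ℝ} (hα : 0 < α) (hγ : 0 < γ) (z : ℝ) :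
    Summable fun m : ℕ => binomialCoeff γ m * z ^ m / Real.Gamma (α * m + β) := by
  set R : ℝ := (2 * (|z| + 1)) ^ α⁻¹
  have hR : 0 < R := by positivity
  have hRα : R ^ α = 2 * (|z| + 1) := Real.rpow_inv_rpow (by positivity) hα.ne'
  refine Summable.of_norm_bounded_eventually_nat
    (g := fun m => Real.exp (2 * R) * R ^ (-β) * (binomialCoeff γ m * (1 / 2 : ℝ) ^ m))
    ((summable_binomialCoeff_mul_half_pow hγ).mul_left _) ?_
  have hlarge : ∀ᶠ m : ℕ in Filter.atTop, 1 ≤ α * m + β :=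
    (Filter.tendsto_atTop_add_const_right _ β
      (tendsto_natCast_atTop_atTop.const_mul_atTop hα)).eventually_ge_atTop 1
  filter_upwards [hlarge] with m hm
  have hΓ := exp_neg_mul_rpow_le_Gamma hR hm
  have hc := binomialCoeff_pos hγ m
  have hpow : R ^ (α * m + β) = (2 * (|z| + 1)) ^ m * R ^ β := by
    rw [Real.rpow_add hR, Real.rpow_mul hR.le, hRα, Real.rpow_natCast]
  have hz : |z| ^ m ≤ (|z| + 1) ^ m := by gcongr; linarith
  rw [norm_div, norm_mul, norm_pow, Real.norm_of_nonneg hc.le, Real.norm_eq_abs,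
    Real.norm_of_nonneg (le_trans (by positivity) hΓ)]
  calc binomialCoeff γ m * |z| ^ m / Real.Gamma (α * m + β)
      ≤ binomialCoeff γ m * (|z| + 1) ^ m / (Real.exp (-(2 * R)) * R ^ (α * m + β)) := by
        gcongr
    _ = _ := by
        rw [hpow, Real.exp_neg, Real.rpow_neg hR.le, mul_pow, div_pow, one_pow]
        field_simp

lemma mittagLeffler3_eq_tsum (α β γ z : ℝ) :
    mittagLeffler3 α β γ z =
      ∑' m : ℕ, binomialCoeff γ m * z ^ m / Real.Gamma (α * m + β) := by
  refine tsum_congr fun m => ?_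
  rw [binomialCoeff, ← mul_div_right_comm, div_div]

lemma ofReal_rpow_mul_sub_rpow {t s : ℝ} (hs : s ∈ Set.Icc 0 t) (a b : ℝ) :
    ((s ^ (a - 1) * (t - s) ^ (b - 1) : ℝ) : ℂ) =
      (s : ℂ) ^ ((a : ℂ) - 1) * ((t : ℂ) - s) ^ ((b : ℂ) - 1) := by
  push_cast [Complex.ofReal_cpow hs.1, Complex.ofReal_cpow (sub_nonneg.2 hs.2)]
  rfl

/-- Euler's beta integral on `[0, t]`. -/
lemma integral_rpow_mul_sub_rpow {a b t : ℝ} (ha : 0 < a) (hb : 0 < b) (ht : 0 < t) :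
    ∫ s in (0 : ℝ)..t, s ^ (a - 1) * (t - s) ^ (b - 1) =
      t ^ (a + b - 1) * (Real.Gamma a * Real.Gamma b / Real.Gamma (a + b)) := by
  have h := Complex.betaIntegral_scaled a b ht
  rw [Complex.betaIntegral_eq_Gamma_mul_div a b (by simpa) (by simpa)] at h
  rw [← Complex.ofReal_inj, ← intervalIntegral.integral_ofReal]
  rw [intervalIntegral.integral_congr fun s hs => ofReal_rpow_mul_sub_rpow
    (by rwa [Set.uIcc_of_le ht.le] at hs) a b, h]
  push_cast [Complex.ofReal_cpow ht.le, ← Complex.Gamma_ofReal]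
  rfl

lemma integrableOn_rpow_mul_sub_rpow {a b t : ℝ} (ha : 0 < a) (hb : 0 < b) (ht : 0 < t) :
    IntegrableOn (fun s : ℝ => s ^ (a - 1) * (t - s) ^ (b - 1)) (Set.Ioc 0 t) := by
  by_contra h
  have h₀ := integral_rpow_mul_sub_rpow ha hb ht
  rw [intervalIntegral.integral_of_le ht.le, integral_undef h] at h₀
  have h₁ := Real.Gamma_pos_of_pos ha
  have h₂ := Real.Gamma_pos_of_pos hb
  have h₃ := Real.Gamma_pos_of_pos (add_pos ha hb)
  have : 0 < t ^ (a + b - 1) * (Real.Gamma a * Real.Gamma b / Real.Gamma (a + b)) := by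
    positivity
  exact this.ne h₀

/-- The contribution of a pair of indices to the product of two Prabhakar kernels. -/
noncomputable def prabhakarTerm (α β₁ β₂ γ₁ γ₂ z t : ℝ) (p : ℕ × ℕ) (s : ℝ) : ℝ :=
  binomialCoeff γ₁ p.1 * binomialCoeff γ₂ p.2 * z ^ (p.1 + p.2) /
    (Real.Gamma (α * p.1 + β₁) * Real.Gamma (α * p.2 + β₂)) *
      (s ^ (α * p.1 + β₁ - 1) * (t - s) ^ (α * p.2 + β₂ - 1))

lemma hasSum_prabhakarTerm {α β₁ β₂ γ₁ γ₂ s t : ℝ} (hα : 0 < α) (hγ₁ : 0 < γ₁)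
    (hγ₂ : 0 < γ₂) (z : ℝ) (hs : s ∈ Set.Ioo 0 t) :
    HasSum (fun p => prabhakarTerm α β₁ β₂ γ₁ γ₂ z t p s)
      ((s ^ (β₁ - 1) * mittagLeffler3 α β₁ γ₁ (z * s ^ α)) *
        ((t - s) ^ (β₂ - 1) * mittagLeffler3 α β₂ γ₂ (z * (t - s) ^ α))) := by
  have hs₂ : 0 < t - s := sub_pos.2 hs.2
  have h₁ := (summable_prabhakar (β := β₁) hα hγ₁ (z * s ^ α)).mul_left (s ^ (β₁ - 1))
  have h₂ := (summable_prabhakar (β := β₂) hα hγ₂ (z * (t - s) ^ α)).mul_left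
    ((t - s) ^ (β₂ - 1))
  have h := h₁.hasSum.mul h₂.hasSum (summable_mul_of_summable_norm h₁.norm h₂.norm)
  rw [tsum_mul_left, tsum_mul_left, ← mittagLeffler3_eq_tsum, ← mittagLeffler3_eq_tsum] at h
  refine h.congr_fun fun p => ?_
  have hpow : ∀ {x : ℝ} (m : ℕ) (β : ℝ), 0 < x →
      x ^ (α * m + β - 1) = (x ^ α) ^ m * x ^ (β - 1) := fun m β hx => by
    rw [add_sub_assoc, Real.rpow_add hx, Real.rpow_mul hx.le, Real.rpow_natCast]
  rw [prabhakarTerm, hpow _ _ hs.1, hpow _ _ hs₂, mul_pow, mul_pow, pow_add]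
  ring

lemma integral_prabhakarTerm {α β₁ β₂ t : ℝ} (γ₁ γ₂ z : ℝ) (hα : 0 < α) (hβ₁ : 0 < β₁)
    (hβ₂ : 0 < β₂) (ht : 0 < t) (p : ℕ × ℕ) :
    ∫ s in Set.Ioc 0 t, prabhakarTerm α β₁ β₂ γ₁ γ₂ z t p s =
      t ^ (β₁ + β₂ - 1) * (binomialCoeff γ₁ p.1 * binomialCoeff γ₂ p.2 *
        ((z * t ^ α) ^ (p.1 + p.2) / Real.Gamma (α * (p.1 + p.2 : ℕ) + (β₁ + β₂)))) := by
  have ha : 0 < α * p.1 + β₁ := by positivity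
  have hb : 0 < α * p.2 + β₂ := by positivity
  have h₁ := (Real.Gamma_pos_of_pos ha).ne'
  have h₂ := (Real.Gamma_pos_of_pos hb).ne'
  have hpow : t ^ (α * p.1 + β₁ + (α * p.2 + β₂) - 1) =
      (t ^ α) ^ (p.1 + p.2) * t ^ (β₁ + β₂ - 1) := by
    rw [← Real.rpow_natCast (t ^ α), ← Real.rpow_mul ht.le, ← Real.rpow_add ht]
    push_cast
    ring_nf
  have hΓ : α * p.1 + β₁ + (α * p.2 + β₂) = α * (p.1 + p.2 : ℕ) + (β₁ + β₂) := by
    push_cast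
    ring
  simp only [prabhakarTerm]
  rw [integral_const_mul, ← intervalIntegral.integral_of_le ht.le,
    integral_rpow_mul_sub_rpow ha hb ht, hpow, hΓ, mul_pow]
  field_simp

lemma norm_prabhakarTerm {α β₁ β₂ γ₁ γ₂ s t : ℝ} (hα : 0 < α) (hβ₁ : 0 < β₁) (hβ₂ : 0 < β₂)
    (hγ₁ : 0 < γ₁) (hγ₂ : 0 < γ₂) (z : ℝ) (p : ℕ × ℕ) (hs : s ∈ Set.Ioc 0 t) :
    ‖prabhakarTerm α β₁ β₂ γ₁ γ₂ z t p s‖ = prabhakarTerm α β₁ β₂ γ₁ γ₂ |z| t p s := by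
  have h₁ : 0 < Real.Gamma (α * p.1 + β₁) := Real.Gamma_pos_of_pos (by positivity)
  have h₂ : 0 < Real.Gamma (α * p.2 + β₂) := Real.Gamma_pos_of_pos (by positivity)
  have h₃ := binomialCoeff_pos hγ₁ p.1
  have h₄ := binomialCoeff_pos hγ₂ p.2
  have h₅ : 0 ≤ s ^ (α * p.1 + β₁ - 1) := Real.rpow_nonneg hs.1.le _
  have h₆ : 0 ≤ (t - s) ^ (α * p.2 + β₂ - 1) := Real.rpow_nonneg (sub_nonneg.2 hs.2) _
  simp only [prabhakarTerm, Real.norm_eq_abs, abs_mul, abs_div, abs_pow, abs_of_pos h₁,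
    abs_of_pos h₂, abs_of_pos h₃, abs_of_pos h₄, abs_of_nonneg h₅, abs_of_nonneg h₆]

lemma summable_integral_prabhakarTerm {α β₁ β₂ γ₁ γ₂ z t : ℝ} (hα : 0 < α) (hβ₁ : 0 < β₁)
    (hβ₂ : 0 < β₂) (hγ₁ : 0 < γ₁) (hγ₂ : 0 < γ₂) (hz : 0 ≤ z) (ht : 0 < t) :
    Summable fun p => ∫ s in Set.Ioc 0 t, prabhakarTerm α β₁ β₂ γ₁ γ₂ z t p s := by
  simp_rw [integral_prabhakarTerm γ₁ γ₂ z hα hβ₁ hβ₂ ht]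
  refine Summable.mul_left _ ?_
  rw [← Finset.HasAntidiagonal.sigmaAntidiagonalEquivProd.summable_iff,
    summable_sigma_of_nonneg]
  · refine ⟨fun N => (hasSum_fintype _).summable, ?_⟩
    refine (summable_prabhakar (β := β₁ + β₂) hα (add_pos hγ₁ hγ₂) (z * t ^ α)).congr
      fun N => ?_
    rw [tsum_fintype, ← sum_antidiagonal_binomialCoeff hγ₁ hγ₂, mul_div_assoc, Finset.sum_mul,
      ← Finset.sum_coe_sort (Finset.HasAntidiagonal.antidiagonal N)]
    refine Finset.sum_congr rfl fun p _ => ?_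
    simp only [Function.comp_apply, Finset.HasAntidiagonal.sigmaAntidiagonalEquivProd_apply,
      Finset.HasAntidiagonal.mem_antidiagonal.1 p.2]
  · rintro ⟨N, p⟩
    have h₁ := binomialCoeff_pos hγ₁ p.1.1
    have h₂ := binomialCoeff_pos hγ₂ p.1.2
    have h₃ : 0 < Real.Gamma (α * (p.1.1 + p.1.2 : ℕ) + (β₁ + β₂)) :=
      Real.Gamma_pos_of_pos (by positivity)
    simp only [Function.comp_apply, Finset.HasAntidiagonal.sigmaAntidiagonalEquivProd_apply]
    positivity

/-- The convolution of two Prabhakar kernels is a Prabhakar kernel. -/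
theorem integral_prabhakar_mul_prabhakar {α β₁ β₂ γ₁ γ₂ t : ℝ} (hα : 0 < α) (hβ₁ : 0 < β₁)
    (hβ₂ : 0 < β₂) (hγ₁ : 0 < γ₁) (hγ₂ : 0 < γ₂) (z : ℝ) (ht : 0 < t) :
    ∫ s in (0 : ℝ)..t, (s ^ (β₁ - 1) * mittagLeffler3 α β₁ γ₁ (z * s ^ α)) *
        ((t - s) ^ (β₂ - 1) * mittagLeffler3 α β₂ γ₂ (z * (t - s) ^ α)) =
      t ^ (β₁ + β₂ - 1) * mittagLeffler3 α (β₁ + β₂) (γ₁ + γ₂) (z * t ^ α) := by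
  have hInt : ∀ p, Integrable (prabhakarTerm α β₁ β₂ γ₁ γ₂ z t p)
      (volume.restrict (Set.Ioc 0 t)) := fun p =>
    (integrableOn_rpow_mul_sub_rpow (by positivity) (by positivity) ht).const_mul _
  have hnorm : Summable fun p => ∫ s in Set.Ioc 0 t, ‖prabhakarTerm α β₁ β₂ γ₁ γ₂ z t p s‖ := by
    refine (summable_integral_prabhakarTerm hα hβ₁ hβ₂ hγ₁ hγ₂ (abs_nonneg z) ht).congr
      fun p => setIntegral_congr_fun measurableSet_Ioc fun s hs =>
        (norm_prabhakarTerm hα hβ₁ hβ₂ hγ₁ hγ₂ z p hs).symm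
  have hsum := hasSum_integral_of_summable_integral_norm hInt hnorm
  have hpoint : ∫ s in (0 : ℝ)..t, (s ^ (β₁ - 1) * mittagLeffler3 α β₁ γ₁ (z * s ^ α)) *
        ((t - s) ^ (β₂ - 1) * mittagLeffler3 α β₂ γ₂ (z * (t - s) ^ α)) =
      ∫ s in Set.Ioc 0 t, ∑' p, prabhakarTerm α β₁ β₂ γ₁ γ₂ z t p s := by
    rw [intervalIntegral.integral_of_le ht.le, integral_Ioc_eq_integral_Ioo,
      integral_Ioc_eq_integral_Ioo]
    exact setIntegral_congr_fun measurableSet_Ioo fun s hs =>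
      (hasSum_prabhakarTerm hα hγ₁ hγ₂ z hs).tsum_eq.symm
  rw [← hpoint, ← Finset.HasAntidiagonal.sigmaAntidiagonalEquivProd.hasSum_iff] at hsum
  rw [← (hsum.sigma fun N => hasSum_fintype _).tsum_eq, mittagLeffler3_eq_tsum, ← tsum_mul_left]
  refine tsum_congr fun N => ?_
  rw [← sum_antidiagonal_binomialCoeff hγ₁ hγ₂, mul_div_assoc, Finset.sum_mul, Finset.mul_sum,
    ← Finset.sum_coe_sort (Finset.HasAntidiagonal.antidiagonal N)]
  refine Finset.sum_congr rfl fun p _ => ?_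
  simp only [Function.comp_apply, Finset.HasAntidiagonal.sigmaAntidiagonalEquivProd_apply,
    integral_prabhakarTerm γ₁ γ₂ z hα hβ₁ hβ₂ ht, Finset.HasAntidiagonal.mem_antidiagonal.1 p.2]

/-- Convolution identity for (generalized) positive-Linnik densities: for
`ν ∈ (0,1]`, `μ > 0`, `j, k ≥ 1` and `t > 0`,
`∫_0^t μ^j s^{νj-1} E^j_{ν,νj}(-μ s^ν) ⬝ μ^k (t-s)^{νk-1} E^k_{ν,νk}(-μ (t-s)^ν) ds
  = μ^{j+k} t^{ν(j+k)-1} E^{j+k}_{ν,ν(j+k)}(-μ t^ν)`. -/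
theorem convolution_prabhakar_densities
    (ν : ℝ) (hν : ν ∈ Set.Ioc (0 : ℝ) 1) (μ : ℝ) (hμ : 0 < μ)
    (j k : ℕ) (hj : 1 ≤ j) (hk : 1 ≤ k) (t : ℝ) (ht : 0 < t) :
    ∫ s in (0 : ℝ)..t,
        (μ ^ j * s ^ (ν * j - 1) * mittagLeffler3 ν (ν * j) j (-(μ * s ^ ν))) *
          (μ ^ k * (t - s) ^ (ν * k - 1) *
            mittagLeffler3 ν (ν * k) k (-(μ * (t - s) ^ ν)))
      = μ ^ (j + k) * t ^ (ν * (j + k) - 1) *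
          mittagLeffler3 ν (ν * (j + k)) (j + k) (-(μ * t ^ ν)) := by
  have hν₀ := hν.1
  have hj₀ : (0 : ℝ) < j := by exact_mod_cast hj
  have hk₀ : (0 : ℝ) < k := by exact_mod_cast hk
  have h := integral_prabhakar_mul_prabhakar hν₀ (mul_pos hν₀ hj₀) (mul_pos hν₀ hk₀) hj₀ hk₀
    (-μ) ht
  simp only [neg_mul] at h
  rw [mul_add, mul_assoc, ← h, ← intervalIntegral.integral_const_mul]
  refine intervalIntegral.integral_congr fun s _ => ?_
  ring
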